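/- arXiv:1210.1763 — 8 statements merged into one kernel-verified Lean document; each statement's English description precedes it below -/
import Mathlib

section
/- For all w₀, w₁, w₂, w₃, w₄ ∈ ℂ, the determinant of the 6×6 skew-symmetric matrix M(w₀,w₁,w₂,w₃,w₄) = M₀₁₂₃(w₀,w₁,w₂,w₃) + w₄·M₄ equals c(w)², where c(w) = w₀w₁w₂ + w₀w₁w₃ + w₀w₂w₃ + w₁w₂w₃ + w₄·(w₀w₁ + a₀₂₄·w₀w₂ + a₀₃₄·w₀w₃ + a₁₂₄·w₁w₂ + a₁₃₄·w₁w₃ + a₂₃₄·w₂w₃). (This is the squared form of the paper's assertion that the Pfaffian of M equals c(w); since M is skew-symmetric the determinant is the square of the Pfaffian.) -/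
noncomputable section

open Matrix

/-- The matrix `M₄` from Definition 4.8 (`defexplicit`) of the paper, depending on the
parameters `a₀₂₄, a₁₂₄, a₁₃₄, a₂₃₄, u, v` (with `e₁, e₂, e₃` as abbreviations). -/
def M4 (a024 a124 a134 a234 u v : ℂ) : Matrix (Fin 6) (Fin 6) ℂ :=
  let e1 : ℂ := a024 + a124 - a234
  let e2 : ℂ := 1 + a124 - a134
  let e3 : ℂ := (-a124 + a134 - 1) * v - a124 - a024 + a234
  !![0, u, -1, a124, e1, e2;
     -u, 0, 0, 0, a024, -u;
     1, 0, 0, 0, -v, 1;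
     -a124, 0, 0, 0, a124 * v, -a124;
     -e1, -a024, v, -a124 * v, 0, e3;
     -e2, u, -1, a124, -e3, 0]

/-- The matrix `M₀₁₂₃` from Definition 4.8 of the paper: the 6×6 skew-symmetric matrix with
block form `[[0, B], [−B, 0]]` where `B` is the symmetric matrix with rows
`(w₀+w₃, w₃, w₃), (w₃, w₁+w₃, w₃), (w₃, w₃, w₂+w₃)`. -/
def M0123 (w0 w1 w2 w3 : ℂ) : Matrix (Fin 6) (Fin 6) ℂ :=
  !![0, 0, 0, w0 + w3, w3, w3;
     0, 0, 0, w3, w1 + w3, w3;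
     0, 0, 0, w3, w3, w2 + w3;
     -(w0 + w3), -w3, -w3, 0, 0, 0;
     -w3, -(w1 + w3), -w3, 0, 0, 0;
     -w3, -w3, -(w2 + w3), 0, 0, 0]

theorem skew_det (a b c d e f g h i j k l m n o : ℂ) :
    (!![0, a, b, c, d, e;
        -a, 0, f, g, h, i;
        -b, -f, 0, j, k, l;
        -c, -g, -j, 0, m, n;
        -d, -h, -k, -m, 0, o;
        -e, -i, -l, -n, -o, 0] : Matrix (Fin 6) (Fin 6) ℂ).det =
    (a * (j * o - k * n + l * m) - b * (g * o - h * n + i * m) + c * (f * o - h * l + i * k)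
      - d * (f * n - g * l + i * j) + e * (f * m - g * k + h * j)) ^ 2 := by
  simp [Matrix.det_succ_row_zero, Fin.sum_univ_succ, Fin.succAbove]
  ring

/-- the determinant of `M(w₀,…,w₄) = M₀₁₂₃(w₀,w₁,w₂,w₃) + w₄·M₄` equals the
square of the cubic form
`c(w) = w₀w₁w₂ + w₀w₁w₃ + w₀w₂w₃ + w₁w₂w₃ + w₄(w₀w₁ + a₀₂₄w₀w₂ + a₀₃₄w₀w₃ + a₁₂₄w₁w₂ +
a₁₃₄w₁w₃ + a₂₃₄w₂w₃)` (the squared form of the paper's computation of the Pfaffian of `M`). -/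
theorem det_eq_pfaffian_sq (a024 a034 a124 a134 a234 u v : ℂ)
    (hu : u ^ 2 + u * (1 + a024 - a034) + a024 = 0)
    (hv : v = -(1 + a024 - a034) - u)
    (w0 w1 w2 w3 w4 : ℂ) :
    (M0123 w0 w1 w2 w3 + w4 • M4 a024 a124 a134 a234 u v).det =
      (w0 * w1 * w2 + w0 * w1 * w3 + w0 * w2 * w3 + w1 * w2 * w3 +
        w4 * (w0 * w1 + a024 * w0 * w2 + a034 * w0 * w3 + a124 * w1 * w2 +
          a134 * w1 * w3 + a234 * w2 * w3)) ^ 2 := by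
  have ha : a034 = 1 + a024 + u + v := by rw [hv]; ring
  have hb : a024 = u * v := by rw [hv]; linear_combination hu
  have hM : M0123 w0 w1 w2 w3 + w4 • M4 a024 a124 a134 a234 u v =
    !![0, (w4*u), (-w4), (w0+w3+w4*a124), (w3+w4*(a024 + a124 - a234)), (w3+w4*(1 + a124 - a134));
     -(w4*u), 0, (0), (w3), (w1+w3+w4*a024), (w3-w4*u);
     -(-w4), -(0), 0, (w3), (w3-w4*v), (w2+w3+w4);
     -(w0+w3+w4*a124), -(w3), -(w3), 0, (w4*(a124*v)), (-(w4*a124));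
     -(w3+w4*(a024 + a124 - a234)), -(w1+w3+w4*a024), -(w3-w4*v), -(w4*(a124*v)), 0, (w4*((-a124 + a134 - 1) * v - a124 - a024 + a234));
     -(w3+w4*(1 + a124 - a134)), -(w3-w4*u), -(w2+w3+w4), -(-(w4*a124)), -(w4*((-a124 + a134 - 1) * v - a124 - a024 + a234)), 0] := by
    ext p q
    fin_cases p <;> fin_cases q <;> simp [M0123, M4] <;> ring
  rw [hM, skew_det, ha, hb]
  ring
end
end

section
/- The 6×6 skew-symmetric complex matrix M₄ has rank exactly 2. -/
noncomputable section

open Matrix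

/-- the 6×6 skew-symmetric matrix `M₄` has rank exactly 2. -/
theorem M4_rank_eq_two (a024 a034 a124 a134 a234 u v : ℂ)
    (hu : u ^ 2 + u * (1 + a024 - a034) + a024 = 0)
    (hv : v = -(1 + a024 - a034) - u) :
    (M4 a024 a124 a134 a234 u v).rank = 2 := by
  have h : a024 = u * v := by subst hv; linear_combination hu
  clear hu hv
  subst h
  apply le_antisymm
  · have hM : M4 (u * v) a124 a134 a234 u v =
        (!![1, 0; 0, -u; 0, 1; 0, -a124; -v, -(u * v + a124 - a234); 1, -(1 + a124 - a134)] :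
          Matrix (Fin 6) (Fin 2) ℂ) *
        (!![0, u, -1, a124, u * v + a124 - a234, 1 + a124 - a134; 1, 0, 0, 0, -v, 1] :
          Matrix (Fin 2) (Fin 6) ℂ) := by
      ext i j
      fin_cases i <;> fin_cases j <;>
        simp [M4, Matrix.mul_apply, Fin.sum_univ_two] <;> ring
    rw [hM]
    refine (Matrix.rank_mul_le_left _ _).trans ?_
    simpa using Matrix.rank_le_card_width
      (!![1, 0; 0, -u; 0, 1; 0, -a124; -v, -(u * v + a124 - a234); 1, -(1 + a124 - a134)] :
          Matrix (Fin 6) (Fin 2) ℂ)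
  · have hP : (!![0, 0, 1, 0, 0, 0; -1, 0, 0, 0, 0, 0] : Matrix (Fin 2) (Fin 6) ℂ) *
        (M4 (u * v) a124 a134 a234 u v *
        (!![1, 0; 0, 0; 0, 1; 0, 0; 0, 0; 0, 0] : Matrix (Fin 6) (Fin 2) ℂ)) = 1 := by
      ext i j
      fin_cases i <;> fin_cases j <;>
        simp [M4, Matrix.mul_apply, Fin.sum_univ_succ]
    have h1 : (1 : Matrix (Fin 2) (Fin 2) ℂ).rank = 2 := by simp [Matrix.rank_one]
    rw [← h1, ← hP]
    exact (Matrix.rank_mul_le_right _ _).trans (Matrix.rank_mul_le_left _ _)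
end
end

section
/- Define N₀ = M₀₁₂₃(1,0,0,0), N₁ = M₀₁₂₃(0,1,0,0), N₂ = M₀₁₂₃(0,0,1,0), N₃ = M₀₁₂₃(0,0,0,1) (so that M₀₁₂₃(w₀,w₁,w₂,w₃) = w₀N₀ + w₁N₁ + w₂N₂ + w₃N₃). Then each of the skew-symmetric matrices N₀, N₁, N₂, N₃ has rank exactly 2, and the five matrices N₀, N₁, N₂, N₃, M₄ are linearly independent in the ℂ-vector space of 6×6 complex matrices. (These five rank-2 skew matrices are the five points of the Grassmannian G(2,6) whose span contains the web of skew forms, producing the inscribed pentahedron of the map Φ₂.) -/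
noncomputable section

open Matrix

lemma rank_two_aux (A : Matrix (Fin 6) (Fin 6) ℂ) (P : Matrix (Fin 6) (Fin 2) ℂ)
    (Q : Matrix (Fin 2) (Fin 6) ℂ) (h1 : A = P * Q) (i j : Fin 6)
    (h : (A.submatrix ![i, j] ![i, j]).det = 1) : A.rank = 2 := by
  apply le_antisymm
  · rw [h1]
    exact (Matrix.rank_mul_le_left _ _).trans (by simpa using Matrix.rank_le_width P)
  · have h2 := Matrix.rank_of_isUnit (A.submatrix ![i, j] ![i, j])
      ((Matrix.isUnit_iff_isUnit_det _).2 (by rw [h]; exact isUnit_one))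
    have h3 := Matrix.rank_submatrix_le A ![i, j] ![i, j]
    rw [Fintype.card_fin] at h2
    omega

/-- with `N₀ = M₀₁₂₃(1,0,0,0)`, `N₁ = M₀₁₂₃(0,1,0,0)`, `N₂ = M₀₁₂₃(0,0,1,0)`,
`N₃ = M₀₁₂₃(0,0,0,1)`, each of the skew-symmetric matrices `N₀, N₁, N₂, N₃` has rank exactly 2,
and the five matrices `N₀, N₁, N₂, N₃, M₄` are linearly independent over ℂ. -/
theorem N_rank_two_and_linearIndependent (a024 a034 a124 a134 a234 u v : ℂ)
    (hu : u ^ 2 + u * (1 + a024 - a034) + a024 = 0)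
    (hv : v = -(1 + a024 - a034) - u) :
    (M0123 1 0 0 0).rank = 2 ∧ (M0123 0 1 0 0).rank = 2 ∧
    (M0123 0 0 1 0).rank = 2 ∧ (M0123 0 0 0 1).rank = 2 ∧
    LinearIndependent ℂ
      ![M0123 1 0 0 0, M0123 0 1 0 0, M0123 0 0 1 0, M0123 0 0 0 1,
        M4 a024 a124 a134 a234 u v] := by
  refine ⟨?_, ?_, ?_, ?_, ?_⟩
  · apply rank_two_aux _ !![1, 0; 0, 0; 0, 0; 0, 1; 0, 0; 0, 0] !![0, 0, 0, 1, 0, 0; -1, 0, 0, 0, 0, 0] ?_ 0 3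
    · rw [Matrix.det_fin_two]; simp [M0123]
    · ext i j
      fin_cases i <;> fin_cases j <;> simp [M0123, Matrix.mul_apply, Fin.sum_univ_two]
  · apply rank_two_aux _ !![0, 0; 1, 0; 0, 0; 0, 0; 0, 1; 0, 0] !![0, 0, 0, 0, 1, 0; 0, -1, 0, 0, 0, 0] ?_ 1 4
    · rw [Matrix.det_fin_two]; simp [M0123]
    · ext i j
      fin_cases i <;> fin_cases j <;> simp [M0123, Matrix.mul_apply, Fin.sum_univ_two]
  · apply rank_two_aux _ !![0, 0; 0, 0; 1, 0; 0, 0; 0, 0; 0, 1] !![0, 0, 0, 0, 0, 1; 0, 0, -1, 0, 0, 0] ?_ 2 5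
    · rw [Matrix.det_fin_two]; simp [M0123]
    · ext i j
      fin_cases i <;> fin_cases j <;> simp [M0123, Matrix.mul_apply, Fin.sum_univ_two]
  · apply rank_two_aux _ !![1, 0; 1, 0; 1, 0; 0, 1; 0, 1; 0, 1] !![0, 0, 0, 1, 1, 1; -1, -1, -1, 0, 0, 0] ?_ 0 3
    · rw [Matrix.det_fin_two]; simp [M0123]
    · ext i j
      fin_cases i <;> fin_cases j <;> simp [M0123, Matrix.mul_apply, Fin.sum_univ_two]
  · rw [Fintype.linearIndependent_iff]
    intro g hg
    have key : ∀ i j, _ := fun i j => congrFun (congrFun hg i) j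
    have k02 := key 0 2
    have k04 := key 0 4
    have k03 := key 0 3
    have k14 := key 1 4
    have k25 := key 2 5
    simp [Fin.sum_univ_succ, M0123, M4, Matrix.add_apply] at k02 k04 k03 k14 k25
    have h4 : g 4 = 0 := k02
    simp [h4] at k04
    have h3 : g 3 = 0 := by simpa using k04
    simp [h4, h3] at k03 k14 k25
    intro i
    fin_cases i <;> simp_all
end
end

section
/- Assume additionally u ≠ 0 and a₁₂₄ ≠ 0. Let P₃ be the 6×6 matrix with rows (indices 0–5): row 0 = (0,0,0,0,0,1); row 1 = (v/u, 0, 0, (−a₀₂₄−a₁₂₄+a₂₃₄)/u, 0, 0); row 2 = (0, 1, 0, 0, 1+a₁₂₄−a₁₃₄, 0); row 3 = (0, 0, −1/a₁₂₄, 0, 0, 0); row 4 = (0,0,0,1,0,0); row 5 = (0,0,0,0,1,0). Then for all w₀, w₁, w₂, w₄ ∈ ℂ, the matrix M′ = P₃ᵀ · M(w₀,w₁,w₂,0,w₄) · P₃ has 3×3 block anti-diagonal form with symmetric off-diagonal block: M′ᵢⱼ = 0 whenever 0 ≤ i,j ≤ 2 or 3 ≤ i,j ≤ 5, and M′_{i,3+j}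 = M′_{j,3+i} for all 0 ≤ i,j ≤ 2. -/
noncomputable section

open Matrix

/-- `M(w₀,w₁,w₂,w₃,w₄) = M₀₁₂₃(w₀,w₁,w₂,w₃) + w₄·M₄`. -/
def Mfull (a024 a124 a134 a234 u v w0 w1 w2 w3 w4 : ℂ) : Matrix (Fin 6) (Fin 6) ℂ :=
  M0123 w0 w1 w2 w3 + w4 • M4 a024 a124 a134 a234 u v

/-- The matrix `P₃` of Theorem 4.9 (`explicit`) of the paper. -/
def P3 (a024 a124 a134 a234 u v : ℂ) : Matrix (Fin 6) (Fin 6) ℂ :=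
  !![0, 0, 0, 0, 0, 1;
     v / u, 0, 0, (-a024 - a124 + a234) / u, 0, 0;
     0, 1, 0, 0, 1 + a124 - a134, 0;
     0, 0, -1 / a124, 0, 0, 0;
     0, 0, 0, 1, 0, 0;
     0, 0, 0, 0, 1, 0]

/-- for `u ≠ 0`, `a₁₂₄ ≠ 0`, the matrix `M′ = P₃ᵀ·M(w₀,w₁,w₂,0,w₄)·P₃` is
block anti-diagonal (its two diagonal 3×3 blocks vanish) with symmetric off-diagonal block. -/
theorem P3_conj_block_antidiag_symm (a024 a034 a124 a134 a234 u v : ℂ)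
    (hu : u ^ 2 + u * (1 + a024 - a034) + a024 = 0)
    (hv : v = -(1 + a024 - a034) - u)
    (hu0 : u ≠ 0) (ha124 : a124 ≠ 0) (w0 w1 w2 w4 : ℂ) :
    (∀ i j : Fin 6,
      ((i.val ≤ 2 ∧ j.val ≤ 2) ∨ (3 ≤ i.val ∧ 3 ≤ j.val)) →
      ((P3 a024 a124 a134 a234 u v)ᵀ * Mfull a024 a124 a134 a234 u v w0 w1 w2 0 w4 *
        P3 a024 a124 a134 a234 u v) i j = 0) ∧
    (∀ i j : Fin 3,
      ((P3 a024 a124 a134 a234 u v)ᵀ * Mfull a024 a124 a134 a234 u v w0 w1 w2 0 w4 *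
        P3 a024 a124 a134 a234 u v)
        ⟨i.val, i.isLt.trans (by norm_num)⟩ ⟨j.val + 3, by have := j.isLt; omega⟩ =
      ((P3 a024 a124 a134 a234 u v)ᵀ * Mfull a024 a124 a134 a234 u v w0 w1 w2 0 w4 *
        P3 a024 a124 a134 a234 u v)
        ⟨j.val, j.isLt.trans (by norm_num)⟩ ⟨i.val + 3, by have := i.isLt; omega⟩) := by
  have huv : a024 = u * v := by rw [hv]; linear_combination hu
  clear hu hv
  subst huv
  refine ⟨?_, ?_⟩
  · intro i j h
    fin_cases i <;> fin_cases j <;> first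
      | (exfalso; revert h; decide)
      | (clear h
         simp [Matrix.mul_apply, Fin.sum_univ_six, P3, Mfull, M0123, M4]
         try field_simp
         try ring)
  · intro i j
    fin_cases i <;> fin_cases j <;> first
      | rfl
      | (simp [Matrix.mul_apply, Fin.sum_univ_six, P3, Mfull, M0123, M4]
         try field_simp
         try ring)
end
end

section
/- Assume additionally a₁₃₄ ≠ 0 and u ≠ −1. Let P₂ be the 6×6 matrix with rows (indices 0–5): row 0 = (1/a₁₃₄, 0, 0, 0, 0, 0); row 1 = (0, (1+v)/(u+1), 0, 0, (−v−a₀₂₄+a₂₃₄+v·a₁₃₄)/(u+1), 0); row 2 = (−1/a₁₃₄, (−1−v)/(u+1), 1, 0, (v+a₀₂₄−a₂₃₄−v·a₁₃₄)/(u+1), a₁₂₄); row 3 = (1/a₁₃₄, 0, 0, 1, 0, 0); row 4 = (0,0,0,0,1,0); row 5 = (−1/a₁₃₄, 0, 0, −1, −1, 1). Then for all w₀, w₁, w₃, w₄ ∈ ℂ, the matrix M′ = P₂ᵀ · M(w₀,w₁,0,w₃,w₄) · P₂ has 3×3 block anti-diagonal form with symmetric off-diagonal block: M′ᵢⱼ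 = 0 whenever 0 ≤ i,j ≤ 2 or 3 ≤ i,j ≤ 5, and M′_{i,3+j} = M′_{j,3+i} for all 0 ≤ i,j ≤ 2. -/
noncomputable section

open Matrix

/-- The matrix `P₂` of Theorem 4.9 (`explicit`) of the paper. -/
def P2 (a024 a124 a134 a234 u v : ℂ) : Matrix (Fin 6) (Fin 6) ℂ :=
  !![1 / a134, 0, 0, 0, 0, 0;
     0, (1 + v) / (u + 1), 0, 0, (-v - a024 + a234 + v * a134) / (u + 1), 0;
     -(1 / a134), (-1 - v) / (u + 1), 1, 0, (v + a024 - a234 - v * a134) / (u + 1), a124;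
     1 / a134, 0, 0, 1, 0, 0;
     0, 0, 0, 0, 1, 0;
     -(1 / a134), 0, 0, -1, -1, 1]

/-- for `a₁₃₄ ≠ 0`, `u ≠ −1`, the matrix `M′ = P₂ᵀ·M(w₀,w₁,0,w₃,w₄)·P₂` is
block anti-diagonal (its two diagonal 3×3 blocks vanish) with symmetric off-diagonal block. -/
theorem P2_conj_block_antidiag_symm (a024 a034 a124 a134 a234 u v : ℂ)
    (hu : u ^ 2 + u * (1 + a024 - a034) + a024 = 0)
    (hv : v = -(1 + a024 - a034) - u)
    (ha134 : a134 ≠ 0) (hu1 : u ≠ -1) (w0 w1 w3 w4 : ℂ) :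
    (∀ i j : Fin 6,
      ((i.val ≤ 2 ∧ j.val ≤ 2) ∨ (3 ≤ i.val ∧ 3 ≤ j.val)) →
      ((P2 a024 a124 a134 a234 u v)ᵀ * Mfull a024 a124 a134 a234 u v w0 w1 0 w3 w4 *
        P2 a024 a124 a134 a234 u v) i j = 0) ∧
    (∀ i j : Fin 3,
      ((P2 a024 a124 a134 a234 u v)ᵀ * Mfull a024 a124 a134 a234 u v w0 w1 0 w3 w4 *
        P2 a024 a124 a134 a234 u v)
        ⟨i.val, i.isLt.trans (by norm_num)⟩ ⟨j.val + 3, by have := j.isLt; omega⟩ =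
      ((P2 a024 a124 a134 a234 u v)ᵀ * Mfull a024 a124 a134 a234 u v w0 w1 0 w3 w4 *
        P2 a024 a124 a134 a234 u v)
        ⟨j.val, j.isLt.trans (by norm_num)⟩ ⟨i.val + 3, by have := i.isLt; omega⟩) := by
  have ha : a024 = u * v := by rw [hv]; linear_combination hu
  have hu2 : u + 1 ≠ 0 := fun h => hu1 (by linear_combination h)
  clear hu hv hu1
  subst ha
  constructor
  · intro i j h
    fin_cases i <;> fin_cases j <;> first
      | (exfalso; revert h; decide)
      | (clear h
         simp [Matrix.mul_apply, Fin.sum_univ_six, P2, Mfull, M0123, M4]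
         try field_simp
         try ring)
  · intro i j
    fin_cases i <;> fin_cases j <;> first
      | rfl
      | (simp [Matrix.mul_apply, Fin.sum_univ_six, P2, Mfull, M0123, M4]
         try field_simp
         try ring)
end
end

section
/- Let T₀₁ be the 3×3 permutation matrix exchanging the first two coordinates (rows (0,1,0),(1,0,0),(0,0,1)), let D₀₁ be the 6×6 block-diagonal matrix diag(T₀₁, T₀₁), and let Q = D₀₁ · P(T) where T = [[ω/√2, (ω²+2)/√2],[−1/√2, −ω/√2]]. Then for all w₀, w₁, w₂, w₃, w₄ ∈ ℂ: Qᵀ · Mᴷ(w₀,w₁,w₂,w₃,w₄) · Q = Mᴷ(w₁,w₀,w₂,w₃,w₄); that is, conjugation by Q exchanges the linear forms w₀ and w₁. -/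
noncomputable section

open Matrix

/-- Reinterpret a matrix indexed by `Fin 3 ⊕ Fin 3` (3×3 block form) as a 6×6 matrix. -/
def toFin6 (A : Matrix (Fin 3 ⊕ Fin 3) (Fin 3 ⊕ Fin 3) ℂ) : Matrix (Fin 6) (Fin 6) ℂ :=
  Matrix.reindex finSumFinEquiv finSumFinEquiv A

/-- For a 2×2 matrix `T = [[t₀,t₁],[t₂,t₃]]`, the 6×6 block matrix
`P(T) = [[t₀·I₃, t₁·I₃],[t₂·I₃, t₃·I₃]]`. -/
def Pblk (t0 t1 t2 t3 : ℂ) : Matrix (Fin 6) (Fin 6) ℂ :=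
  toFin6 (fromBlocks (t0 • 1) (t1 • 1) (t2 • 1) (t3 • 1))

/-- For a 3×3 matrix `T`, the 6×6 block-diagonal matrix `diag(T, T)`. -/
def Dblk (T : Matrix (Fin 3) (Fin 3) ℂ) : Matrix (Fin 6) (Fin 6) ℂ :=
  toFin6 (fromBlocks T 0 0 T)

/-- The Klein-case matrix `M₄ᴷ` (with `ω` a primitive cube root of unity). -/
def M4K (ω : ℂ) : Matrix (Fin 6) (Fin 6) ℂ :=
  !![0, ω, -1, 1, 1, 1;
     -ω, 0, 0, 0, 1, -ω;
     1, 0, 0, 0, -ω ^ 2, 1;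
     -1, 0, 0, 0, ω ^ 2, -1;
     -1, -1, ω ^ 2, -ω ^ 2, 0, ω;
     -1, ω, -1, 1, -ω, 0]

/-- `Mᴷ(w₀,w₁,w₂,w₃,w₄) = M₀₁₂₃(w₀,w₁,w₂,w₃) + w₄·M₄ᴷ`. -/
def MK (ω w0 w1 w2 w3 w4 : ℂ) : Matrix (Fin 6) (Fin 6) ℂ :=
  M0123 w0 w1 w2 w3 + w4 • M4K ω

/-- The permutation matrix `T₀₁` exchanging the first two coordinates. -/
def T01 : Matrix (Fin 3) (Fin 3) ℂ := !![0, 1, 0; 1, 0, 0; 0, 0, 1]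

theorem Q_explicit (a b c d : ℂ) : Dblk T01 * Pblk a b c d =
    !![0, a, 0, 0, b, 0;
       a, 0, 0, b, 0, 0;
       0, 0, a, 0, 0, b;
       0, c, 0, 0, d, 0;
       c, 0, 0, d, 0, 0;
       0, 0, c, 0, 0, d] := by
  have h0 : finSumFinEquiv.symm (0 : Fin (3+3)) = Sum.inl 0 := by decide
  have h1 : finSumFinEquiv.symm (1 : Fin (3+3)) = Sum.inl 1 := by decide
  have h2 : finSumFinEquiv.symm (2 : Fin (3+3)) = Sum.inl 2 := by decide
  have h3 : finSumFinEquiv.symm (3 : Fin (3+3)) = Sum.inr 0 := by decide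
  have h4 : finSumFinEquiv.symm (4 : Fin (3+3)) = Sum.inr 1 := by decide
  have h5 : finSumFinEquiv.symm (5 : Fin (3+3)) = Sum.inr 2 := by decide
  have hm : Dblk T01 * Pblk a b c d =
      toFin6 (fromBlocks (a • T01) (b • T01) (c • T01) (d • T01)) := by
    unfold Dblk Pblk toFin6
    simp only [reindex_apply]
    rw [submatrix_mul_equiv, fromBlocks_multiply]
    simp
  rw [hm]
  unfold toFin6
  ext i j
  rw [reindex_apply, submatrix_apply]
  fin_cases i <;> fin_cases j <;>
    simp [h0, h1, h2, h3, h4, h5, T01]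

/-- with `Q = D₀₁·P(T)` for `T = [[ω/√2, (ω²+2)/√2],[−1/√2, −ω/√2]]`,
conjugation by `Q` exchanges the linear forms `w₀` and `w₁` in `Mᴷ`. -/
theorem Q01_conj_swaps_w0_w1 (ω : ℂ) (hω : ω ^ 2 + ω + 1 = 0)
    (w0 w1 w2 w3 w4 : ℂ) :
    (Dblk T01 * Pblk (ω / (Real.sqrt 2 : ℂ)) ((ω ^ 2 + 2) / (Real.sqrt 2 : ℂ))
        (-(1 / (Real.sqrt 2 : ℂ))) (-(ω / (Real.sqrt 2 : ℂ))))ᵀ *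
      MK ω w0 w1 w2 w3 w4 *
      (Dblk T01 * Pblk (ω / (Real.sqrt 2 : ℂ)) ((ω ^ 2 + 2) / (Real.sqrt 2 : ℂ))
        (-(1 / (Real.sqrt 2 : ℂ))) (-(ω / (Real.sqrt 2 : ℂ)))) =
    MK ω w1 w0 w2 w3 w4 := by
  rw [Q_explicit]
  have hs : ((Real.sqrt 2 : ℂ))⁻¹ * ((Real.sqrt 2 : ℂ))⁻¹ = 1 / 2 := by
    rw [← mul_inv, ← Complex.ofReal_mul, Real.mul_self_sqrt (by norm_num)]
    norm_num
  simp only [div_eq_mul_inv, one_mul] at hs ⊢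
  generalize ((Real.sqrt 2 : ℂ))⁻¹ = s at hs ⊢
  have h2 : ω ^ 2 = -ω - 1 := by linear_combination hω
  unfold MK M0123 M4K
  rw [h2]
  ext i j
  fin_cases i <;> fin_cases j <;>
    simp [Matrix.mul_apply, Fin.sum_univ_six] <;> grind
end
end

section
/- The subspace K = {φ ∈ (⋀⁴V)* : φ(w∧w′) = 0 for all w, w′ ∈ W₄} of the dual space of ⋀⁴V has dimension 5 over ℂ. Equivalently, the ℂ-linear map from (⋀⁴V)* (which has dimension 15) to the space of symmetric bilinear forms on W₄ (which has dimension 10), sending φ to the form (w, w′) ↦ φ(w∧w′), is surjective. (In the paper's language: the space H⁰(I_{π₃ ∪ G(2,V₆)}(2)) of quadrics containing both the projective 3-space P(W₄) and the Grassmannian of lines has dimension 5 for this W₄.) -/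
set_option synthInstance.maxHeartbeats 1000000
set_option maxHeartbeats 1000000

noncomputable section

open ExteriorAlgebra

/-- `V = ℂ⁶`. -/
abbrev V : Type := Fin 6 → ℂ

/-- The standard basis vectors `ε₀, …, ε₅` of `V`. -/
def ε (i : Fin 6) : V := Pi.single i 1

/-- The wedge `a ∧ b` of two vectors of `V`, as an element of the second exterior power
`⋀[ℂ]^2 V` (a submodule of the exterior algebra of `V`). -/
def wedge2 (a b : V) : ⋀[ℂ]^2 V :=
  ⟨ι ℂ a * ι ℂ b, by
    have h := Submodule.mul_mem_mul (LinearMap.mem_range_self (ι ℂ (M := V)) a)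
      (LinearMap.mem_range_self (ι ℂ (M := V)) b)
    simpa [pow_two] using h⟩

/-- The wedge of two bivectors, as an element of the fourth exterior power `⋀[ℂ]^4 V`. -/
def wedge4 (w w' : ⋀[ℂ]^2 V) : ⋀[ℂ]^4 V :=
  ⟨w.1 * w'.1, by
    have h := Submodule.mul_mem_mul w.2 w'.2
    rwa [← pow_add] at h⟩

/-- The five decomposable bivectors `u₀ = ε₀∧ε₃`, `u₁ = ε₁∧ε₄`, `u₂ = ε₂∧ε₅`,
`u₃ = (ε₀+ε₁+ε₂)∧(ε₄+ε₃+ε₅)`, `u₄ = (ε₁+ε₄+ε₂)∧(ε₃+ε₁+ε₅)` of the paper's example. -/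
def u : Fin 5 → ⋀[ℂ]^2 V :=
  ![wedge2 (ε 0) (ε 3), wedge2 (ε 1) (ε 4), wedge2 (ε 2) (ε 5),
    wedge2 (ε 0 + ε 1 + ε 2) (ε 4 + ε 3 + ε 5),
    wedge2 (ε 1 + ε 4 + ε 2) (ε 3 + ε 1 + ε 5)]

/-- The linear functional `λ ↦ λ₀ + ⋯ + λ₄` on `ℂ⁵`. -/
def sumCoeff : (Fin 5 → ℂ) →ₗ[ℂ] ℂ := ∑ i, LinearMap.proj i

/-- The linear map `λ ↦ λ₀•u₀ + ⋯ + λ₄•u₄`. -/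
def combo : (Fin 5 → ℂ) →ₗ[ℂ] ↥(⋀[ℂ]^2 V) := ∑ i, (LinearMap.proj i).smulRight (u i)

/-- `W₄ = {λ₀u₀ + ⋯ + λ₄u₄ : λᵢ ∈ ℂ, λ₀ + ⋯ + λ₄ = 0} ⊆ ⋀²V`. -/
def W4 : Submodule ℂ ↥(⋀[ℂ]^2 V) := Submodule.map combo (LinearMap.ker sumCoeff)

/-- `K = {φ ∈ (⋀⁴V)* : φ(w∧w′) = 0 for all w, w′ ∈ W₄}`, a subspace of the dual space
of `⋀⁴V`. -/
def K : Submodule ℂ (Module.Dual ℂ ↥(⋀[ℂ]^4 V)) where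
  carrier := {φ | ∀ w ∈ W4, ∀ w' ∈ W4, φ (wedge4 w w') = 0}
  zero_mem' := by intro w hw w' hw'; rfl
  add_mem' := by
    intro φ ψ hφ hψ w hw w' hw'
    simp [LinearMap.add_apply, hφ w hw w' hw', hψ w hw w' hw']
  smul_mem' := by
    intro c φ hφ w hw w' hw'
    simp [LinearMap.smul_apply, hφ w hw w' hw']

/-- The determinant functional on the fourth exterior power for the coordinates `s`. -/
def detF (s : Fin 4 → Fin 6) : ⋀[ℂ]^4 V →ₗ[ℂ] ℂ :=
  exteriorPower.alternatingMapLinearEquiv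
    ((Matrix.detRowAlternating (R := ℂ) (n := Fin 4)).compLinearMap (LinearMap.funLeft ℂ ℂ s))

lemma detF_wedge (s : Fin 4 → Fin 6) (a b c d : V) :
    detF s (wedge4 (wedge2 a b) (wedge2 c d)) =
      Matrix.det (Matrix.of fun i j => (![a, b, c, d] : Fin 4 → V) i (s j)) := by
  have h : wedge4 (wedge2 a b) (wedge2 c d) = exteriorPower.ιMulti ℂ 4 ![a, b, c, d] := by
    apply Subtype.ext
    simp [wedge4, wedge2, ExteriorAlgebra.ιMulti_apply, mul_assoc]
  rw [h, detF, exteriorPower.alternatingMapLinearEquiv_apply_ιMulti]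
  rfl

lemma detF_wedge' (i j k l : Fin 6) (a b c d : V) :
    detF ![i, j, k, l] (wedge4 (wedge2 a b) (wedge2 c d)) =
      (a i * b j - a j * b i) * (c k * d l - c l * d k)
      - (a i * b k - a k * b i) * (c j * d l - c l * d j)
      + (a i * b l - a l * b i) * (c j * d k - c k * d j)
      + (a j * b k - a k * b j) * (c i * d l - c l * d i)
      - (a j * b l - a l * b j) * (c i * d k - c k * d i)
      + (a k * b l - a l * b k) * (c i * d j - c j * d i) := by
  rw [detF_wedge, Matrix.det_succ_row_zero]
  simp [Fin.sum_univ_succ, Matrix.det_fin_three, Fin.succAbove]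
  ring

lemma ε_apply (i j : Fin 6) : ε i j = if j = i then 1 else 0 := by
  simp [ε, Pi.single_apply]

lemma wedge4_add_left (a b c : ⋀[ℂ]^2 V) : wedge4 (a + b) c = wedge4 a c + wedge4 b c :=
  Subtype.ext (add_mul a.1 b.1 c.1)

lemma wedge4_add_right (a b c : ⋀[ℂ]^2 V) : wedge4 a (b + c) = wedge4 a b + wedge4 a c :=
  Subtype.ext (mul_add a.1 b.1 c.1)

lemma wedge4_smul_left (r : ℂ) (a c : ⋀[ℂ]^2 V) : wedge4 (r • a) c = r • wedge4 a c :=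
  Subtype.ext (smul_mul_assoc r a.1 c.1)

lemma wedge4_smul_right (r : ℂ) (a c : ⋀[ℂ]^2 V) : wedge4 a (r • c) = r • wedge4 a c :=
  Subtype.ext (mul_smul_comm r a.1 c.1)

lemma ι_swap (a b : V) : ι ℂ a * ι ℂ b = - (ι ℂ b * ι ℂ a) :=
  eq_neg_of_add_eq_zero_left (ExteriorAlgebra.ι_add_mul_swap a b)

lemma wedge4_comm (a b c d : V) :
    wedge4 (wedge2 a b) (wedge2 c d) = wedge4 (wedge2 c d) (wedge2 a b) := by
  apply Subtype.ext
  change ι ℂ a * ι ℂ b * (ι ℂ c * ι ℂ d) = ι ℂ c * ι ℂ d * (ι ℂ a * ι ℂ b)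
  calc ι ℂ a * ι ℂ b * (ι ℂ c * ι ℂ d) = ι ℂ a * (ι ℂ b * ι ℂ c) * ι ℂ d := by noncomm_ring
    _ = - ((ι ℂ a * ι ℂ c) * (ι ℂ b * ι ℂ d)) := by rw [ι_swap b c]; noncomm_ring
    _ = - (ι ℂ c * (ι ℂ a * ι ℂ d) * ι ℂ b) := by rw [ι_swap a c, ι_swap b d]; noncomm_ring
    _ = _ := by rw [ι_swap a d]; noncomm_ring

lemma wedge4_self (a b : V) : wedge4 (wedge2 a b) (wedge2 a b) = 0 := by
  apply Subtype.ext
  change ι ℂ a * ι ℂ b * (ι ℂ a * ι ℂ b) = 0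
  calc ι ℂ a * ι ℂ b * (ι ℂ a * ι ℂ b) = ι ℂ a * (ι ℂ b * ι ℂ a) * ι ℂ b := by noncomm_ring
    _ = - ((ι ℂ a * ι ℂ a) * (ι ℂ b * ι ℂ b)) := by rw [ι_swap b a]; noncomm_ring
    _ = 0 := by simp

lemma u_decomp (i : Fin 5) : ∃ a b : V, u i = wedge2 a b := by
  fin_cases i <;> exact ⟨_, _, rfl⟩

lemma u_comm (i j : Fin 5) : wedge4 (u i) (u j) = wedge4 (u j) (u i) := by
  obtain ⟨a, b, h⟩ := u_decomp i
  obtain ⟨c, d, h'⟩ := u_decomp j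
  rw [h, h', wedge4_comm]

lemma u_self (i : Fin 5) : wedge4 (u i) (u i) = 0 := by
  obtain ⟨a, b, h⟩ := u_decomp i
  rw [h, wedge4_self]

/-- The ten products. -/
def pp : Fin 10 → ⋀[ℂ]^4 V :=
  ![wedge4 (u 0) (u 1), wedge4 (u 0) (u 2), wedge4 (u 0) (u 3), wedge4 (u 0) (u 4),
    wedge4 (u 1) (u 2), wedge4 (u 1) (u 3), wedge4 (u 1) (u 4),
    wedge4 (u 2) (u 3), wedge4 (u 2) (u 4), wedge4 (u 3) (u 4)]

lemma pp_exists (k : Fin 10) : ∃ i j, pp k = wedge4 (u i) (u j) := by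
  fin_cases k <;> exact ⟨_, _, rfl⟩

lemma mem_K_iff_u (φ : Module.Dual ℂ (⋀[ℂ]^4 V)) :
    φ ∈ K ↔ ∀ i j, φ (wedge4 (u i) (u j)) = 0 := by
  constructor
  · intro h i j
    have hw : u i + (-1 : ℂ) • u j ∈ W4 := by
      refine ⟨Pi.single i 1 + (-1 : ℂ) • Pi.single j 1, ?_, ?_⟩
      · simp [sumCoeff, Finset.sum_add_distrib]
      · simp [combo, Pi.single_apply, add_smul, Finset.sum_add_distrib, ite_smul]
        exact (neg_one_smul ℂ (u j)).symm
    have h2 := h _ hw _ hw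
    simp only [wedge4_add_left, wedge4_add_right, wedge4_smul_left, wedge4_smul_right, u_self,
      map_add, map_smul, u_comm j i, smul_eq_mul, map_zero] at h2
    linear_combination (-1 / 2 : ℂ) * h2
  · rintro h w ⟨c, -, rfl⟩ w' ⟨c', -, rfl⟩
    simp [combo, Fin.sum_univ_five, wedge4_add_left, wedge4_add_right, wedge4_smul_left,
      wedge4_smul_right, h]

lemma K_eq : K = (Submodule.span ℂ (Set.range pp)).dualAnnihilator := by
  ext φ
  rw [mem_K_iff_u, Submodule.mem_dualAnnihilator]
  constructor
  · intro h w hw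
    induction hw using Submodule.span_induction with
    | mem x hx =>
      obtain ⟨k, rfl⟩ := hx
      obtain ⟨i, j, e⟩ := pp_exists k
      rw [e, h]
    | zero => simp
    | add x y _ _ hx hy => simp [hx, hy]
    | smul a x _ hx => simp [hx]
  · intro h
    have hk : ∀ k, φ (pp k) = 0 := fun k => h _ (Submodule.subset_span ⟨k, rfl⟩)
    have key : ∀ i j : Fin 5, i < j → φ (wedge4 (u i) (u j)) = 0 := by
      intro i j hij
      fin_cases i <;> fin_cases j <;> first
        | exact absurd hij (by decide)
        | exact hk 0
        | exact hk 1
        | exact hk 2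
        | exact hk 3
        | exact hk 4
        | exact hk 5
        | exact hk 6
        | exact hk 7
        | exact hk 8
        | exact hk 9
    intro i j
    rcases lt_trichotomy i j with hij | rfl | hij
    · exact key i j hij
    · rw [u_self, map_zero]
    · rw [u_comm]; exact key j i hij

lemma pp_indep : LinearIndependent ℂ pp := by
  rw [Fintype.linearIndependent_iff]
  intro g hg
  have H : ∀ i j k l, ∑ m, g m * detF ![i, j, k, l] (pp m) = 0 := by
    intro i j k l
    have := congrArg (detF ![i, j, k, l]) hg
    simpa using this
  simp only [Fin.sum_univ_succ, pp, u, Matrix.cons_val_zero, Matrix.cons_val_succ, Matrix.cons_val,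
    Fin.sum_univ_zero, Finset.univ_eq_empty, Finset.sum_empty, detF_wedge', Pi.add_apply] at H
  have h0124 := H 0 1 2 4
  simp [ε_apply] at h0124
  have h0345 := H 0 3 4 5
  simp [ε_apply] at h0345
  have h0234 := H 0 2 3 4
  simp [ε_apply] at h0234
  have h0145 := H 0 1 4 5
  simp [ε_apply] at h0145
  have h1234 := H 1 2 3 4
  simp [ε_apply] at h1234
  have h0245 := H 0 2 4 5
  simp [ε_apply] at h0245
  have h2345 := H 2 3 4 5
  simp [ε_apply] at h2345
  have h0134 := H 0 1 3 4
  simp [ε_apply] at h0134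
  have h0235 := H 0 2 3 5
  simp [ε_apply] at h0235
  have h1245 := H 1 2 4 5
  simp [ε_apply] at h1245
  clear H hg
  have e2 : g 2 = 0 := by linear_combination h0124 - h0234
  have e5 : g 5 = 0 := by linear_combination h0145 + 2 * h0124
  have e6 : g 6 = 0 := by linear_combination h1234 - e5 + h0124
  have e7 : g 7 = 0 := by linear_combination -h0245 - h0124
  have e0 : g 0 = 0 := by linear_combination -h0134 - e2 + h0345 - e5 + 2 * h0124
  have e1 : g 1 = 0 := by linear_combination -h0235 - e2 - h0345 - e7
  have e4 : g 4 = 0 := by linear_combination -h1245 - e5 - e6 - e7 + h2345 + h0124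
  intro i
  fin_cases i <;> assumption

/-- the space `K` of linear functionals on `⋀⁴V` vanishing on all products
`w∧w′` with `w, w′ ∈ W₄` has dimension 5 over ℂ (the paper's statement that
`h⁰(I_{π₃ ∪ G(2,V₆)}(2)) = 5` for this `W₄`). -/
theorem K_finrank_eq_five : Module.finrank ℂ ↥K = 5 := by
  have h1 := Subspace.finrank_add_finrank_dualAnnihilator_eq (Submodule.span ℂ (Set.range pp))
  rw [← K_eq, finrank_span_eq_card pp_indep, exteriorPower.finrank_eq] at h1
  simp [Nat.choose] at h1
  omega
end
end

section
/- Let W₅⊥ = {x ∈ ⋀²V : φ(x∧w) = 0 for all φ ∈ K and all w ∈ W₄}. Suppose W ⊆ ⋀²V is a 5-dimensional ℂ-subspace with W₄ ⊆ W for which there exist linearly independent decomposable elements x₀, …, x₄ ∈ W (each xⱼ = aⱼ∧bⱼ for some aⱼ, bⱼ ∈ V) such that every decomposable element of W is a scalar multiple of one of x₀, …, x₄. Then W ⊆ W₅⊥, and consequently W = W₅⊥; in particular there is at most one such subspace W. (This is the instance, at the paper's explicit example W₄, of the proposition that a general 3-dimensional projective subspace of P(⋀²V₆) lies in a unique 4-dimensional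 projective subspace meeting the Grassmannian G(2,V₆) in exactly 5 linearly independent points.) -/
set_option synthInstance.maxHeartbeats 1000000
set_option maxHeartbeats 1000000

noncomputable section

open ExteriorAlgebra

/-- The subspace `{x ∈ ⋀²V : φ(x∧w) = 0 for all φ ∈ K and all w ∈ W₄}` of `⋀²V`:
the intersection of the orthogonal complements of `W₄` with respect to the polar forms of
all quadrics vanishing on both `P(W₄)` and the Grassmannian of decomposable bivectors. -/
def W5perp : Submodule ℂ ↥(⋀[ℂ]^2 V) where
  carrier := {x | ∀ φ ∈ K, ∀ w ∈ W4, φ (wedge4 x w) = 0}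
  zero_mem' := by
    intro φ hφ w hw
    have h0 : wedge4 0 w = 0 := by
      apply Subtype.ext; simp [wedge4]
    rw [h0, map_zero]
  add_mem' := by
    intro x y hx hy φ hφ w hw
    have h : wedge4 (x + y) w = wedge4 x w + wedge4 y w := by
      apply Subtype.ext; simp [wedge4, add_mul]
    rw [h, map_add, hx φ hφ w hw, hy φ hφ w hw, add_zero]
  smul_mem' := by
    intro c x hx φ hφ w hw
    have h : wedge4 (c • x) w = c • wedge4 x w := by
      apply Subtype.ext; simp [wedge4, smul_mul_assoc]
    rw [h, map_smul, hx φ hφ w hw, smul_zero]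

set_option linter.unusedSimpArgs false

def Cf (n : ℕ) (f : Fin n → Fin 6) : ↥(⋀[ℂ]^n V) →ₗ[ℂ] ℂ :=
  exteriorPower.alternatingMapLinearEquiv
    ((Matrix.detRowAlternating (R := ℂ) (n := Fin n)).compLinearMap (LinearMap.funLeft ℂ ℂ f))

lemma Cf_apply (n : ℕ) (f : Fin n → Fin 6) (v : Fin n → V) :
    Cf n f (exteriorPower.ιMulti ℂ n v) = Matrix.det (Matrix.of fun r c => v r (f c)) := by
  rw [Cf, exteriorPower.alternatingMapLinearEquiv_apply_ιMulti]
  rfl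

lemma wedge2_eq (a b : V) : wedge2 a b = exteriorPower.ιMulti ℂ 2 ![a, b] := by
  apply Subtype.ext
  simp [wedge2, ExteriorAlgebra.ιMulti_apply]

lemma wedge4_eq (a b c d : V) :
    wedge4 (wedge2 a b) (wedge2 c d) = exteriorPower.ιMulti ℂ 4 ![a, b, c, d] := by
  apply Subtype.ext
  simp [wedge4, wedge2, ExteriorAlgebra.ιMulti_apply, mul_assoc]

def D (i j : Fin 6) : ↥(⋀[ℂ]^2 V) →ₗ[ℂ] ℂ := Cf 2 ![i, j]
def C (i j k l : Fin 6) : ↥(⋀[ℂ]^4 V) →ₗ[ℂ] ℂ := Cf 4 ![i, j, k, l]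

lemma D_wedge (i j : Fin 6) (a b : V) : D i j (wedge2 a b) = a i * b j - a j * b i := by
  rw [wedge2_eq, D, Cf_apply, Matrix.det_fin_two]
  simp

lemma C_wedge (i j k l : Fin 6) (a b c d : V) :
    C i j k l (wedge4 (wedge2 a b) (wedge2 c d)) =
      D i j (wedge2 a b) * D k l (wedge2 c d) - D i k (wedge2 a b) * D j l (wedge2 c d)
      + D i l (wedge2 a b) * D j k (wedge2 c d) + D j k (wedge2 a b) * D i l (wedge2 c d)
      - D j l (wedge2 a b) * D i k (wedge2 c d) + D k l (wedge2 a b) * D i j (wedge2 c d) := by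
  simp only [D_wedge]
  rw [wedge4_eq, C, Cf_apply]
  simp [Matrix.det_succ_row_zero, Fin.sum_univ_succ, Fin.succAbove]
  ring

lemma wind {P : ↥(⋀[ℂ]^2 V) → Prop} (h : ∀ a b, P (wedge2 a b)) (h0 : P 0)
    (ha : ∀ x y, P x → P y → P (x + y)) (hs : ∀ (c : ℂ) x, P x → P (c • x))
    (x : ↥(⋀[ℂ]^2 V)) : P x := by
  have hx : x ∈ Submodule.span ℂ (Set.range (exteriorPower.ιMulti ℂ 2 (M := V))) := by
    rw [exteriorPower.ιMulti_span]; trivial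
  induction hx using Submodule.span_induction with
  | mem y hy =>
    obtain ⟨v, rfl⟩ := hy
    have := h (v 0) (v 1)
    rw [wedge2_eq] at this
    convert this using 2
    ext i; fin_cases i <;> rfl
  | zero => exact h0
  | add y z _ _ hy hz => exact ha _ _ hy hz
  | smul c y _ hy => exact hs _ _ hy

/-- bilinear -/
def wl : ↥(⋀[ℂ]^2 V) →ₗ[ℂ] ↥(⋀[ℂ]^2 V) →ₗ[ℂ] ↥(⋀[ℂ]^4 V) :=
  LinearMap.mk₂ ℂ wedge4
    (by intro x y z; apply Subtype.ext; simp [wedge4, add_mul])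
    (by intro c x y; apply Subtype.ext; simp [wedge4])
    (by intro x y z; apply Subtype.ext; simp [wedge4, mul_add])
    (by intro c x y; apply Subtype.ext; simp [wedge4])

lemma wl_eq (x y) : wl x y = wedge4 x y := rfl

lemma C_wedge4 (i j k l : Fin 6) (x y : ↥(⋀[ℂ]^2 V)) :
    C i j k l (wedge4 x y) =
      D i j x * D k l y - D i k x * D j l y + D i l x * D j k y + D j k x * D i l y
      - D j l x * D i k y + D k l x * D i j y := by
  rw [← wl_eq]
  induction x using wind with
  | h a b =>
    induction y using wind with
    | h c d => exact C_wedge ..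
    | h0 => simp
    | ha x y hx hy => simp only [map_add, hx, hy]; ring
    | hs c x hx => simp only [map_smul, hx, smul_eq_mul]; ring
  | h0 => simp
  | ha x y hx hy => simp only [map_add, LinearMap.add_apply, hx, hy]; ring
  | hs c x hx => simp only [map_smul, LinearMap.smul_apply, hx, smul_eq_mul]; ring

lemma wedge4_comm_s13 (x y : ↥(⋀[ℂ]^2 V)) : wedge4 x y = wedge4 y x := by
  rw [← wl_eq, ← wl_eq]
  induction x using wind with
  | h a b =>
    induction y using wind with
    | h c d =>
      rw [wl_eq, wl_eq]
      apply Subtype.ext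
      have s : ∀ p q : V, ι ℂ p * ι ℂ q = - (ι ℂ q * ι ℂ p) := fun p q =>
        eq_neg_of_add_eq_zero_left (ι_add_mul_swap p q)
      change ι ℂ a * ι ℂ b * (ι ℂ c * ι ℂ d) = ι ℂ c * ι ℂ d * (ι ℂ a * ι ℂ b)
      calc ι ℂ a * ι ℂ b * (ι ℂ c * ι ℂ d) = ι ℂ a * (ι ℂ b * ι ℂ c) * ι ℂ d := by
            simp only [mul_assoc]
        _ = - ((ι ℂ a * ι ℂ c) * (ι ℂ b * ι ℂ d)) := by rw [s b c]; simp [mul_assoc]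
        _ = - (ι ℂ c * (ι ℂ a * ι ℂ d) * ι ℂ b) := by rw [s a c, s b d]; simp [mul_assoc]
        _ = _ := by rw [s a d]; simp [mul_assoc]
    | h0 => simp
    | ha x y hx hy => simp only [map_add, LinearMap.add_apply, hx, hy]
    | hs c x hx => simp only [map_smul, LinearMap.smul_apply, hx]
  | h0 => simp
  | ha x y hx hy => simp only [map_add, LinearMap.add_apply, hx, hy]
  | hs c x hx => simp only [map_smul, LinearMap.smul_apply, hx]

def w2l : V →ₗ[ℂ] V →ₗ[ℂ] ↥(⋀[ℂ]^2 V) :=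
  LinearMap.mk₂ ℂ wedge2
    (by intro x y z; apply Subtype.ext; simp [wedge2, add_mul])
    (by intro c x y; apply Subtype.ext; simp [wedge2])
    (by intro x y z; apply Subtype.ext; simp [wedge2, mul_add])
    (by intro c x y; apply Subtype.ext; simp [wedge2])

lemma wedge2_swap (a b : V) : wedge2 b a = - wedge2 a b := by
  apply Subtype.ext
  exact eq_neg_of_add_eq_zero_left (ι_add_mul_swap b a)

lemma wedge2_expand (a b : V) :
    wedge2 a b = ∑ i, ∑ j, (a i * b j) • wedge2 (ε i) (ε j) := by
  have e : ∀ a : V, a = ∑ i, a i • ε i := fun a => by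
    ext j; simp [ε, Finset.sum_apply, Pi.single_apply]
  change w2l a b = ∑ i, ∑ j, (a i * b j) • w2l (ε i) (ε j)
  conv_lhs => rw [e a, e b]
  simp only [map_sum, LinearMap.sum_apply, map_smul, LinearMap.smul_apply, Finset.smul_sum,
    smul_smul]
  rw [Finset.sum_comm]
  simp only [mul_comm]

lemma expand (x : ↥(⋀[ℂ]^2 V)) :
    (2 : ℂ) • x = ∑ i, ∑ j, D i j x • wedge2 (ε i) (ε j) := by
  induction x using wind with
  | h a b =>
    have h2 : wedge2 (-b) a = wedge2 a b := by
      rw [← neg_neg (wedge2 a b), ← wedge2_swap a b]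
      apply Subtype.ext; simp [wedge2]
    have h3 : ∀ i j, D i j (wedge2 a b) = a i * b j + (-b) i * a j := by
      intro i j; rw [D_wedge, Pi.neg_apply]; ring
    simp only [h3, add_smul, Finset.sum_add_distrib]
    rw [← wedge2_expand, ← wedge2_expand, h2, two_smul]
  | h0 => simp
  | ha x y hx hy => simp only [map_add, add_smul, smul_add, hx, hy, Finset.sum_add_distrib]
  | hs c x hx => 
    rw [smul_comm, hx]
    simp only [map_smul, smul_eq_mul, mul_smul, Finset.smul_sum]

lemma D_swap (i j : Fin 6) (x : ↥(⋀[ℂ]^2 V)) : D j i x = - D i j x := by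
  induction x using wind with
  | h a b => simp only [D_wedge]; ring
  | h0 => simp
  | ha x y hx hy => simp only [map_add, hx, hy]; ring
  | hs c x hx => simp only [map_smul, hx, smul_eq_mul]; ring

lemma D_self (i : Fin 6) (x : ↥(⋀[ℂ]^2 V)) : D i i x = 0 := by
  have := D_swap i i x
  exact self_eq_neg.mp this

lemma D_ext (x y : ↥(⋀[ℂ]^2 V)) (h : ∀ i j, i < j → D i j x = D i j y) : x = y := by
  have h' : ∀ i j, D i j x = D i j y := by
    intro i j
    rcases lt_trichotomy i j with h1 | h1 | h1
    · exact h i j h1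
    · subst h1; rw [D_self, D_self]
    · rw [D_swap j i, D_swap j i y, h j i h1]
  have : (2 : ℂ) • x = (2 : ℂ) • y := by
    rw [expand, expand]; simp only [h']
  exact smul_right_injective _ (two_ne_zero) this

lemma combo_apply (l : Fin 5 → ℂ) : combo l = l 0 • wedge2 (ε 0) (ε 3) + l 1 • wedge2 (ε 1) (ε 4)
   + l 2 • wedge2 (ε 2) (ε 5) + l 3 • wedge2 (ε 0 + ε 1 + ε 2) (ε 4 + ε 3 + ε 5)
   + l 4 • wedge2 (ε 1 + ε 4 + ε 2) (ε 3 + ε 1 + ε 5) := by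
  simp [combo, u, Fin.sum_univ_five]

/-- coordinates of `combo l` -/
def cc (l : Fin 5 → ℂ) : Fin 6 → Fin 6 → ℂ :=
  fun i j => l 0 * (ε 0 i * ε 3 j - ε 0 j * ε 3 i) + l 1 * (ε 1 i * ε 4 j - ε 1 j * ε 4 i)
   + l 2 * (ε 2 i * ε 5 j - ε 2 j * ε 5 i)
   + l 3 * ((ε 0 + ε 1 + ε 2) i * (ε 4 + ε 3 + ε 5) j - (ε 0 + ε 1 + ε 2) j * (ε 4 + ε 3 + ε 5) i)
   + l 4 * ((ε 1 + ε 4 + ε 2) i * (ε 3 + ε 1 + ε 5) j - (ε 1 + ε 4 + ε 2) j * (ε 3 + ε 1 + ε 5) i)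

lemma D_combo (i j) (l : Fin 5 → ℂ) : D i j (combo l) = cc l i j := by
  rw [combo_apply]
  simp only [map_add, map_smul, D_wedge, smul_eq_mul, cc]

lemma D01 (l : Fin 5 → ℂ) : D 0 1 (combo l) = 0 := by
  rw [D_combo]; simp [cc, ε]
lemma D02 (l : Fin 5 → ℂ) : D 0 2 (combo l) = 0 := by
  rw [D_combo]; simp [cc, ε]
lemma D03 (l : Fin 5 → ℂ) : D 0 3 (combo l) = l 0 + l 3 := by
  rw [D_combo]; simp [cc, ε]
lemma D04 (l : Fin 5 → ℂ) : D 0 4 (combo l) = l 3 := by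
  rw [D_combo]; simp [cc, ε]
lemma D05 (l : Fin 5 → ℂ) : D 0 5 (combo l) = l 3 := by
  rw [D_combo]; simp [cc, ε]
lemma D12 (l : Fin 5 → ℂ) : D 1 2 (combo l) = -l 4 := by
  rw [D_combo]; simp [cc, ε]
lemma D13 (l : Fin 5 → ℂ) : D 1 3 (combo l) = l 3 + l 4 := by
  rw [D_combo]; simp [cc, ε]
lemma D14 (l : Fin 5 → ℂ) : D 1 4 (combo l) = l 1 + l 3 + -l 4 := by
  rw [D_combo]; simp [cc, ε]
lemma D15 (l : Fin 5 → ℂ) : D 1 5 (combo l) = l 3 + l 4 := by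
  rw [D_combo]; simp [cc, ε]
lemma D23 (l : Fin 5 → ℂ) : D 2 3 (combo l) = l 3 + l 4 := by
  rw [D_combo]; simp [cc, ε]
lemma D24 (l : Fin 5 → ℂ) : D 2 4 (combo l) = l 3 := by
  rw [D_combo]; simp [cc, ε]
lemma D25 (l : Fin 5 → ℂ) : D 2 5 (combo l) = l 2 + l 3 + l 4 := by
  rw [D_combo]; simp [cc, ε]
lemma D34 (l : Fin 5 → ℂ) : D 3 4 (combo l) = -l 4 := by
  rw [D_combo]; simp [cc, ε]
lemma D35 (l : Fin 5 → ℂ) : D 3 5 (combo l) = 0 := by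
  rw [D_combo]; simp [cc, ε]
lemma D45 (l : Fin 5 → ℂ) : D 4 5 (combo l) = l 4 := by
  rw [D_combo]; simp [cc, ε]

lemma combo_zero_of_sq (l : Fin 5 → ℂ) (hs : l 0 + l 1 + l 2 + l 3 + l 4 = 0)
    (h : wedge4 (combo l) (combo l) = 0) : l = 0 := by
  have H : ∀ i j k m, C i j k m (wedge4 (combo l) (combo l)) = 0 := by
    intro i j k m; rw [h, map_zero]
  have h0134 := H 0 1 3 4
  have h0235 := H 0 2 3 5
  have h0135 := H 0 1 3 5
  have h0234 := H 0 2 3 4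
  have h0123 := H 0 1 2 3
  have h0345 := H 0 3 4 5
  have h0145 := H 0 1 4 5
  have h1234 := H 1 2 3 4
  have h2345 := H 2 3 4 5
  have h1235 := H 1 2 3 5
  have h1245 := H 1 2 4 5
  simp only [C_wedge4, D01, D02, D03, D04, D05, D12, D13, D14, D15, D23, D24, D25, D34, D35, D45] at h0134 h0235 h0135 h0234 h0123 h0345 h0145 h1234 h2345 h1235 h1245
  clear H h
  have p04 : l 0 * l 4 = 0 := by grind
  have p34 : l 3 * l 4 = 0 := by grind
  have p03 : l 0 * l 3 = 0 := by grind
  have p13 : l 1 * l 3 = 0 := by grind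
  have p14 : l 1 * l 4 = 0 := by grind
  have p01 : l 0 * l 1 = 0 := by grind
  have p24 : l 2 * l 4 = 0 := by grind
  have p23 : l 2 * l 3 = 0 := by grind
  have p02 : l 0 * l 2 = 0 := by grind
  have p12 : l 1 * l 2 = 0 := by grind
  have q0 : l 0 = 0 := by
    have : l 0 * l 0 = 0 := by linear_combination l 0 * hs - p01 - p02 - p03 - p04
    exact mul_self_eq_zero.mp this
  have q1 : l 1 = 0 := by
    have : l 1 * l 1 = 0 := by linear_combination l 1 * hs - p01 - p12 - p13 - p14
    exact mul_self_eq_zero.mp this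
  have q2 : l 2 = 0 := by
    have : l 2 * l 2 = 0 := by linear_combination l 2 * hs - p02 - p12 - p23 - p24
    exact mul_self_eq_zero.mp this
  have q3 : l 3 = 0 := by
    have : l 3 * l 3 = 0 := by linear_combination l 3 * hs - p03 - p13 - p23 - p34
    exact mul_self_eq_zero.mp this
  have q4 : l 4 = 0 := by
    have : l 4 * l 4 = 0 := by linear_combination l 4 * hs - p04 - p14 - p24 - p34
    exact mul_self_eq_zero.mp this
  ext i; fin_cases i <;> simp [q0, q1, q2, q3, q4]

def ph0 : Module.Dual ℂ ↥(⋀[ℂ]^4 V) := -C 0 1 2 4 + C 0 1 2 5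

lemma ph0_mem : ph0 ∈ K := by
  rintro _ ⟨l, -, rfl⟩ _ ⟨m, -, rfl⟩
  simp only [ph0, LinearMap.add_apply, LinearMap.sub_apply, LinearMap.neg_apply, C_wedge4, D01, D02, D03, D04, D05, D12, D13, D14, D15, D23, D24, D25, D34, D35, D45]
  ring

def ph1 : Module.Dual ℂ ↥(⋀[ℂ]^4 V) := C 0 1 2 3 - C 0 1 3 5 + C 0 2 3 4

lemma ph1_mem : ph1 ∈ K := by
  rintro _ ⟨l, -, rfl⟩ _ ⟨m, -, rfl⟩
  simp only [ph1, LinearMap.add_apply, LinearMap.sub_apply, LinearMap.neg_apply, C_wedge4, D01, D02, D03, D04, D05, D12, D13, D14, D15, D23, D24, D25, D34, D35, D45]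
  ring

def ph2 : Module.Dual ℂ ↥(⋀[ℂ]^4 V) := C 0 1 2 3 - C 0 1 2 4 + C 0 3 4 5

lemma ph2_mem : ph2 ∈ K := by
  rintro _ ⟨l, -, rfl⟩ _ ⟨m, -, rfl⟩
  simp only [ph2, LinearMap.add_apply, LinearMap.sub_apply, LinearMap.neg_apply, C_wedge4, D01, D02, D03, D04, D05, D12, D13, D14, D15, D23, D24, D25, D34, D35, D45]
  ring

def ph3 : Module.Dual ℂ ↥(⋀[ℂ]^4 V) := C 1 3 4 5

lemma ph3_mem : ph3 ∈ K := by
  rintro _ ⟨l, -, rfl⟩ _ ⟨m, -, rfl⟩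
  simp only [ph3, LinearMap.add_apply, LinearMap.sub_apply, LinearMap.neg_apply, C_wedge4, D01, D02, D03, D04, D05, D12, D13, D14, D15, D23, D24, D25, D34, D35, D45]
  ring

def ph4 : Module.Dual ℂ ↥(⋀[ℂ]^4 V) := -C 0 1 2 4 + C 0 2 4 5 - C 1 2 3 5 + C 2 3 4 5

lemma ph4_mem : ph4 ∈ K := by
  rintro _ ⟨l, -, rfl⟩ _ ⟨m, -, rfl⟩
  simp only [ph4, LinearMap.add_apply, LinearMap.sub_apply, LinearMap.neg_apply, C_wedge4, D01, D02, D03, D04, D05, D12, D13, D14, D15, D23, D24, D25, D34, D35, D45]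
  ring

lemma mem_W4 (l : Fin 5 → ℂ) (h : l 0 + l 1 + l 2 + l 3 + l 4 = 0) : combo l ∈ W4 :=
  ⟨l, by simpa [sumCoeff, Fin.sum_univ_five] using h, rfl⟩

lemma W5perp_le : W5perp ≤ LinearMap.range combo := by
  intro x hx
  have key : ∀ φ ∈ K, ∀ i : Fin 5, i ≠ 4 → φ (wedge4 x (combo (Pi.single i 1 - Pi.single 4 1))) = 0 := by
    intro φ hφ i hi
    refine hx φ hφ _ (mem_W4 _ ?_)
    fin_cases i <;> simp at hi ⊢
  have k00 := key ph0 ph0_mem 0 (by decide)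
  have k01 := key ph0 ph0_mem 1 (by decide)
  have k02 := key ph0 ph0_mem 2 (by decide)
  have k03 := key ph0 ph0_mem 3 (by decide)
  have k10 := key ph1 ph1_mem 0 (by decide)
  have k11 := key ph1 ph1_mem 1 (by decide)
  have k12 := key ph1 ph1_mem 2 (by decide)
  have k13 := key ph1 ph1_mem 3 (by decide)
  have k20 := key ph2 ph2_mem 0 (by decide)
  have k21 := key ph2 ph2_mem 1 (by decide)
  have k22 := key ph2 ph2_mem 2 (by decide)
  have k23 := key ph2 ph2_mem 3 (by decide)
  have k30 := key ph3 ph3_mem 0 (by decide)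
  have k31 := key ph3 ph3_mem 1 (by decide)
  have k32 := key ph3 ph3_mem 2 (by decide)
  have k33 := key ph3 ph3_mem 3 (by decide)
  have k40 := key ph4 ph4_mem 0 (by decide)
  have k41 := key ph4 ph4_mem 1 (by decide)
  have k42 := key ph4 ph4_mem 2 (by decide)
  have k43 := key ph4 ph4_mem 3 (by decide)
  simp [ph0, ph1, ph2, ph3, ph4, LinearMap.add_apply, LinearMap.sub_apply, LinearMap.neg_apply, C_wedge4, D01, D02, D03, D04, D05, D12, D13, D14, D15, D23, D24, D25, D34, D35, D45] at k00 k01 k02 k03 k10 k11 k12 k13 k20 k21 k22 k23 k30 k31 k32 k33 k40 k41 k42 k43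
  clear key hx
  refine ⟨![D 0 3 x - D 2 4 x, D 1 4 x - D 2 4 x + D 4 5 x, D 2 5 x - D 2 4 x - D 4 5 x, D 2 4 x, D 4 5 x], ?_⟩
  apply D_ext
  intro i j hij
  have g01 : D 0 1 x = 0 := by grind
  have g02 : D 0 2 x = 0 := by grind
  have g04 : D 0 4 x = D 2 4 x := by grind
  have g05 : D 0 5 x = D 2 4 x := by grind
  have g12 : D 1 2 x = - D 4 5 x := by grind
  have g13 : D 1 3 x = D 2 4 x + D 4 5 x := by grind
  have g15 : D 1 5 x = D 2 4 x + D 4 5 x := by grind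
  have g23 : D 2 3 x = D 2 4 x + D 4 5 x := by grind
  have g34 : D 3 4 x = - D 4 5 x := by grind
  have g35 : D 3 5 x = 0 := by grind
  fin_cases i <;> fin_cases j <;> first | (exfalso; revert hij; decide) | simp [D01, D02, D03, D04, D05, D12, D13, D14, D15, D23, D24, D25, D34, D35, D45, g01, g02, g04, g05, g12, g13, g15, g23, g34, g35]
  all_goals ring

lemma combo_inj : Function.Injective combo := by
  rw [← LinearMap.ker_eq_bot, LinearMap.ker_eq_bot']
  intro l h
  have H : ∀ i j, D i j (combo l) = 0 := by intro i j; rw [h, map_zero]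
  have h1 := H 0 4
  have h2 := H 1 2
  have h3 := H 0 3
  have h4 := H 1 4
  have h5 := H 2 5
  simp only [D04, D12, D03, D14, D25] at h1 h2 h3 h4 h5
  have q0 : l 0 = 0 := by grind
  have q1 : l 1 = 0 := by grind
  have q2 : l 2 = 0 := by grind
  have q4 : l 4 = 0 := by grind
  ext i; fin_cases i <;> simp [q0, q1, q2, h1, q4]

lemma finrank_W4 : 4 ≤ Module.finrank ℂ ↥W4 := by
  have h1 : Module.finrank ℂ ↥W4 = Module.finrank ℂ ↥(LinearMap.ker sumCoeff) :=
    (Submodule.equivMapOfInjective combo combo_inj _).finrank_eq.symm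
  have h2 := LinearMap.finrank_range_add_finrank_ker sumCoeff
  have h3 := Submodule.finrank_le (LinearMap.range sumCoeff)
  simp only [Module.finrank_self, Module.finrank_fin_fun] at h2 h3
  omega

/-- if `W ⊆ ⋀²V` is a 5-dimensional subspace containing `W₄` which contains
five linearly independent decomposable bivectors `x₀, …, x₄` such that every decomposable
element of `W` is a scalar multiple of one of them, then `W ⊆ W₅⊥` and consequently
`W = W₅⊥`; in particular there is at most one such subspace `W`. -/
theorem unique_five_secant_space (W : Submodule ℂ ↥(⋀[ℂ]^2 V))
    (hdim : Module.finrank ℂ ↥W = 5)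
    (hW4 : W4 ≤ W)
    (x : Fin 5 → ↥(⋀[ℂ]^2 V))
    (hxW : ∀ j, x j ∈ W)
    (hxdec : ∀ j, ∃ a b : V, x j = wedge2 a b)
    (hxli : LinearIndependent ℂ x)
    (hxall : ∀ y ∈ W, (∃ a b : V, y = wedge2 a b) → ∃ (j : Fin 5) (c : ℂ), y = c • x j) :
    W ≤ W5perp ∧ W = W5perp := by
  have hfin : Module.finrank ℂ ↥W5perp ≤ 5 := by
    refine (Submodule.finrank_mono W5perp_le).trans ?_
    refine (LinearMap.finrank_range_le combo).trans ?_
    simp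
  have hnot : ∀ j, x j ∉ W4 := by
    intro j hj
    obtain ⟨l, hl, hlx⟩ := hj
    obtain ⟨a, b, hab⟩ := hxdec j
    have hl' : l 0 + l 1 + l 2 + l 3 + l 4 = 0 := by
      have : sumCoeff l = 0 := hl
      simpa [sumCoeff, Fin.sum_univ_five] using this
    have hz : l = 0 := by
      apply combo_zero_of_sq l hl'
      rw [hlx, hab]; exact wedge4_self a b
    apply hxli.ne_zero j
    rw [← hlx, hz, map_zero]
  have hspan : Submodule.span ℂ (Set.range x) = W := by
    apply Submodule.eq_of_le_of_finrank_le
    · rw [Submodule.span_le]; rintro _ ⟨j, rfl⟩; exact hxW j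
    · rw [hdim, finrank_span_eq_card hxli]; simp
  have hsup : ∀ j, W4 ⊔ Submodule.span ℂ {x j} = W := by
    intro j
    apply Submodule.eq_of_le_of_finrank_le
    · refine sup_le hW4 ?_
      rw [Submodule.span_singleton_le_iff_mem]; exact hxW j
    · have hlt : W4 < W4 ⊔ Submodule.span ℂ {x j} := by
        refine lt_of_le_of_ne le_sup_left ?_
        intro he
        apply hnot j
        rw [he]
        exact Submodule.mem_sup_right (Submodule.mem_span_singleton_self _)
      have h1 := Submodule.finrank_lt_finrank_of_lt hlt
      have h2 := finrank_W4
      omega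
  have hself : ∀ j, wedge4 (x j) (x j) = 0 := by
    intro j
    obtain ⟨a, b, hab⟩ := hxdec j
    rw [hab]; exact wedge4_self a b
  have hle : W ≤ W5perp := by
    intro y hy φ hφ w hw
    have hB : ∀ i j, φ (wl (x i) (x j)) = 0 := by
      intro i j
      have hi : x i ∈ W4 ⊔ Submodule.span ℂ {x j} := by rw [hsup j]; exact hxW i
      obtain ⟨v, hv, z, hz, hvz⟩ := Submodule.mem_sup.mp hi
      obtain ⟨c, rfl⟩ := Submodule.mem_span_singleton.mp hz
      have hc : c ≠ 0 := by
        rintro rfl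
        apply hnot i
        rw [← hvz]; simpa using hv
      have e1 : φ (wl v v) = 0 := hφ v hv v hv
      have e2 : wl (x i) (x i) = 0 := hself i
      have e3 : wl (x j) (x j) = 0 := hself j
      have e4 : wl (x j) v = wl v (x j) := wedge4_comm_s13 _ _
      rw [← hvz] at e2 ⊢
      have e5 := congrArg φ e2
      simp only [map_add, map_smul, LinearMap.add_apply, LinearMap.smul_apply, e3, e4, e1,
        smul_eq_mul, map_zero] at e5 ⊢
      have e6 : c * φ (wl v (x j)) = 0 := by linear_combination e5 / 2
      have e7 := (mul_eq_zero.mp e6).resolve_left hc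
      rw [e7]; simp
    have hw' : w ∈ Submodule.span ℂ (Set.range x) := by rw [hspan]; exact hW4 hw
    rw [← hspan] at hy
    rw [← wl_eq]
    clear hw
    induction hy using Submodule.span_induction with
    | mem y hy =>
      obtain ⟨i, rfl⟩ := hy
      induction hw' using Submodule.span_induction with
      | mem z hz => obtain ⟨j, rfl⟩ := hz; exact hB i j
      | zero => simp
      | add p q _ _ hp hq => simp [hp, hq]
      | smul c p _ hp => simp [hp]
    | zero => simp
    | add p q _ _ hp hq => simp [hp, hq]
    | smul c p _ hp => simp [hp]
  refine ⟨hle, Submodule.eq_of_le_of_finrank_le hle ?_⟩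
  rw [hdim]; exact hfin
end
end
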